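/- There exists a constant c > 0 such that the fraction of n×n matrices M over F_2 for which the minimum size of a cancellation-free linear circuit computing M is at most c times the minimum size of a linear circuit computing M tends to 1 as n → ∞; that is, for almost every matrix the cancellation ratio is bounded by a constant. -/

import Mathlib

/-- A linear circuit over `F_2` with `n` inputs, given as a straight-line program.
Vertices `0, …, n-1` are the inputs `x_1, …, x_n`; vertex `n + g` is gate `g`.
Each gate has in-degree two: its two children `left g` and `right g` are earlier
vertices, and the gate computes the XOR of its children. -/
structure LinCircuit (n : ℕ) where
  gates : ℕ
  left : Fin gates → ℕ
  right : Fin gates → ℕ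
  left_lt : ∀ g, left g < n + g.val
  right_lt : ∀ g, right g < n + g.val

namespace LinCircuit

variable {n : ℕ}

/-- The value vector `κ(v) ∈ F_2^n` of the vertex `v`: for an input `x_i` it is
the `i`-th standard unit vector, and for a gate it is the sum of the value
vectors of its two children. -/
def val (C : LinCircuit n) (v : ℕ) : Fin n → ZMod 2 :=
  if _h1 : v < n then fun j => if (j : ℕ) = v then 1 else 0
  else if h2 : v - n < C.gates then
    C.val (C.left ⟨v - n, h2⟩) + C.val (C.right ⟨v - n, h2⟩)
  else 0
termination_by v
decreasing_by
  · have := C.left_lt ⟨v - n, h2⟩; simp only [Fin.val_mk] at this; omega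
  · have := C.right_lt ⟨v - n, h2⟩; simp only [Fin.val_mk] at this; omega

/-- `C` computes the `m × n` matrix `A` if there are `m` designated output
vertices whose value vectors are exactly the rows of `A`. -/
def Computes {m : ℕ} (C : LinCircuit n) (A : Matrix (Fin m) (Fin n) (ZMod 2)) : Prop :=
  ∃ out : Fin m → ℕ, (∀ o, out o < n + C.gates) ∧ ∀ o j, C.val (out o) j = A o j

/-- `Edge C w u`: there is a wire from vertex `w` to vertex `u`,
i.e. `u` is a gate having `w` as one of its two children. -/
def Edge (C : LinCircuit n) (w u : ℕ) : Prop :=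
  ∃ g : Fin C.gates, u = n + g.val ∧ (C.left g = w ∨ C.right g = w)

/-- A circuit is cancellation-free if along every directed path the value
vectors only grow in the coordinatewise partial order. -/
def CancellationFree (C : LinCircuit n) : Prop :=
  ∀ w u : ℕ, Relation.TransGen C.Edge w u → ∀ i : Fin n, C.val w i = 1 → C.val u i = 1

end LinCircuit

/-- The minimum size of a cancellation-free linear circuit computing `A`. -/
noncomputable def cfMin (n : ℕ) (A : Matrix (Fin n) (Fin n) (ZMod 2)) : ℕ :=
  sInf {s | ∃ C : LinCircuit n, C.CancellationFree ∧ C.Computes A ∧ C.gates = s}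

/-- The minimum size of a linear circuit (cancellation allowed) computing `A`. -/
noncomputable def linMin (n : ℕ) (A : Matrix (Fin n) (Fin n) (ZMod 2)) : ℕ :=
  sInf {s | ∃ C : LinCircuit n, C.Computes A ∧ C.gates = s}

namespace LinCircuit

variable {n : ℕ}

theorem val_input (C : LinCircuit n) (v : ℕ) (h : v < n) :
    C.val v = fun j : Fin n => if (j : ℕ) = v then (1 : ZMod 2) else 0 := by
  rw [val]; simp [h]

theorem val_gate (C : LinCircuit n) (g : Fin C.gates) :
    C.val (n + g.val) = C.val (C.left g) + C.val (C.right g) := by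
  rw [val]; simp

def snoc (C : LinCircuit n) (a b : ℕ) (ha : a < n + C.gates) (hb : b < n + C.gates) :
    LinCircuit n where
  gates := C.gates + 1
  left g := if h : g.val < C.gates then C.left ⟨g.val, h⟩ else a
  right g := if h : g.val < C.gates then C.right ⟨g.val, h⟩ else b
  left_lt g := by
    split_ifs with h
    · exact C.left_lt ⟨g.val, h⟩
    · have := g.isLt; omega
  right_lt g := by
    split_ifs with h
    · exact C.right_lt ⟨g.val, h⟩
    · have := g.isLt; omega

theorem val_snoc (C : LinCircuit n) (a b : ℕ) (ha : a < n + C.gates) (hb : b < n + C.gates)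
    (v : ℕ) (hv : v < n + C.gates) : (C.snoc a b ha hb).val v = C.val v := by
  induction v using Nat.strong_induction_on with
  | _ v ih =>
    by_cases h : v < n
    · rw [val_input _ _ h, val_input _ _ h]
    · obtain ⟨g, rfl⟩ := Nat.exists_eq_add_of_le (not_lt.mp h)
      have hg : g < C.gates := by omega
      have e1 := val_gate C ⟨g, hg⟩
      have e2 := val_gate (C.snoc a b ha hb) ⟨g, Nat.lt_succ_of_lt hg⟩
      have hl := C.left_lt ⟨g, hg⟩
      have hr := C.right_lt ⟨g, hg⟩
      simp only [snoc, hg, dif_pos] at e1 e2 hl hr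
      rw [e1]
      refine e2.trans ?_
      have i1 := ih _ hl (by omega)
      have i2 := ih _ hr (by omega)
      simp only [snoc] at i1 i2
      rw [i1, i2]

theorem val_snoc_last (C : LinCircuit n) (a b : ℕ) (ha : a < n + C.gates) (hb : b < n + C.gates) :
    (C.snoc a b ha hb).val (n + C.gates) = C.val a + C.val b := by
  have e2 := val_gate (C.snoc a b ha hb) ⟨C.gates, Nat.lt_succ_self _⟩
  have i1 := val_snoc C a b ha hb a ha
  have i2 := val_snoc C a b ha hb b hb
  simp only [snoc, lt_irrefl, dif_neg, not_false_eq_true] at e2 i1 i2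
  rw [← i1, ← i2]
  exact e2

def LocalCF (C : LinCircuit n) : Prop :=
  ∀ g i, C.val (C.left g) i = 0 ∨ C.val (C.right g) i = 0

theorem LocalCF.snoc {C : LinCircuit n} (hC : C.LocalCF) (a b : ℕ) (ha : a < n + C.gates)
    (hb : b < n + C.gates) (h : ∀ i, C.val a i = 0 ∨ C.val b i = 0) :
    (C.snoc a b ha hb).LocalCF := by
  intro g i
  by_cases hg : g.val < C.gates
  · have e1 : (C.snoc a b ha hb).left g = C.left ⟨g.val, hg⟩ := by simp [LinCircuit.snoc, hg]
    have e2 : (C.snoc a b ha hb).right g = C.right ⟨g.val, hg⟩ := by simp [LinCircuit.snoc, hg]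
    have hl := C.left_lt ⟨g, hg⟩
    have hr := C.right_lt ⟨g, hg⟩
    simp only at hl hr
    rw [e1, e2, val_snoc _ _ _ _ _ _ (by omega), val_snoc _ _ _ _ _ _ (by omega)]
    exact hC _ _
  · have e1 : (C.snoc a b ha hb).left g = a := by simp [LinCircuit.snoc, hg]
    have e2 : (C.snoc a b ha hb).right g = b := by simp [LinCircuit.snoc, hg]
    rw [e1, e2, val_snoc _ _ _ _ _ _ ha, val_snoc _ _ _ _ _ _ hb]
    exact h i

theorem LocalCF.cancellationFree {C : LinCircuit n} (hC : C.LocalCF) : C.CancellationFree := by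
  have key : ∀ w u, C.Edge w u → ∀ i, C.val w i = 1 → C.val u i = 1 := by
    rintro w u ⟨g, rfl, h⟩ i hw
    rw [val_gate, Pi.add_apply]
    rcases h with rfl | rfl
    · rcases hC g i with h0 | h0
      · rw [h0] at hw; exact absurd hw (by decide)
      · rw [h0, hw, add_zero]
    · rcases hC g i with h0 | h0
      · rw [h0, hw, zero_add]
      · rw [h0] at hw; exact absurd hw (by decide)
  intro w u h
  induction h with
  | single h => exact key _ _ h
  | tail _ h ih => exact fun i hi => key _ _ h i (ih i hi)

theorem CancellationFree.val_ne {C : LinCircuit n} (hC : C.CancellationFree) (v : ℕ)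
    (hv : v < n + C.gates) : ∃ i, C.val v i = 1 := by
  induction v using Nat.strong_induction_on with
  | _ v ih =>
    by_cases h : v < n
    · exact ⟨⟨v, h⟩, by rw [val_input _ _ h]; simp⟩
    · obtain ⟨g, rfl⟩ := Nat.exists_eq_add_of_le (not_lt.mp h)
      have hg : g < C.gates := by omega
      have hl := C.left_lt ⟨g, hg⟩
      simp only at hl
      obtain ⟨i, hi⟩ := ih _ hl (by omega)
      exact ⟨i, hC _ _ (Relation.TransGen.single ⟨⟨g, hg⟩, rfl, Or.inl rfl⟩) i hi⟩

def ind (A : Finset (Fin n)) : Fin n → ZMod 2 := fun j => if j ∈ A then 1 else 0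

inductive Reach (n : ℕ) : ℕ → Set (Finset (Fin n)) → Prop
  | base : Reach n 0 {T | T.card ≤ 1}
  | step {s S A B} : Reach n s S → A ∈ S → B ∈ S → Disjoint A B → Reach n (s + 1) (insert (A ∪ B) S)
  | mono {s S t T} : Reach n s S → s ≤ t → T ⊆ S → Reach n t T

theorem Reach.circuit {s : ℕ} {S : Set (Finset (Fin n))} (h : Reach n s S) :
    ∃ C : LinCircuit n, C.gates ≤ s ∧ C.LocalCF ∧
      ∀ A ∈ S, A.Nonempty → ∃ v, v < n + C.gates ∧ C.val v = ind A := by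
  induction h with
  | base =>
    refine ⟨⟨0, Fin.elim0, Fin.elim0, fun g => g.elim0, fun g => g.elim0⟩, le_rfl,
      fun g => g.elim0, ?_⟩
    intro A hA hne
    obtain ⟨a, rfl⟩ := Finset.card_eq_one.mp (le_antisymm hA (Finset.card_pos.mpr hne))
    refine ⟨a.val, a.isLt, ?_⟩
    rw [val_input _ _ a.isLt]
    funext j
    simp [ind, Fin.ext_iff]
  | @step s S A B _ hA hB hd ih =>
    obtain ⟨C, hC, hl, hS⟩ := ih
    by_cases hAB : A.Nonempty ∧ B.Nonempty
    · obtain ⟨a, ha, va⟩ := hS A hA hAB.1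
      obtain ⟨b, hb, vb⟩ := hS B hB hAB.2
      refine ⟨C.snoc a b ha hb, Nat.succ_le_succ hC, hl.snoc a b ha hb ?_, ?_⟩
      · intro i
        rw [va, vb]
        by_cases hi : i ∈ A
        · right; simp [ind, Finset.disjoint_left.mp hd hi]
        · left; simp [ind, hi]
      · rintro X (rfl | hX) hne
        · refine ⟨n + C.gates, by simp [LinCircuit.snoc], ?_⟩
          rw [val_snoc_last, va, vb]
          funext i
          by_cases hi : i ∈ A
          · simp [ind, hi, Finset.disjoint_left.mp hd hi]
          · simp [ind, hi]
        · obtain ⟨v, hv, e⟩ := hS X hX hne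
          exact ⟨v, by simp only [LinCircuit.snoc]; omega, by rw [val_snoc _ _ _ _ _ _ hv, e]⟩
    · refine ⟨C, by omega, hl, ?_⟩
      rintro X (rfl | hX) hne
      · by_cases h1 : A.Nonempty
        · have h2 : B = ∅ := by
            by_contra h; exact hAB ⟨h1, Finset.nonempty_iff_ne_empty.mpr h⟩
          subst h2
          simpa using hS A hA h1
        · have h2 : A = ∅ := Finset.not_nonempty_iff_eq_empty.mp h1
          subst h2
          rw [Finset.empty_union] at hne ⊢
          exact hS B hB hne
      · exact hS X hX hne
  | mono _ hst hT ih =>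
    obtain ⟨C, hC, hl, hS⟩ := ih
    exact ⟨C, hC.trans hst, hl, fun A hA => hS A (hT hA)⟩

theorem Reach.many {s : ℕ} {S : Set (Finset (Fin n))} (h : Reach n s S)
    (T : Finset (Finset (Fin n)))
    (hT : ∀ X ∈ T, ∃ A ∈ S, ∃ B ∈ S, Disjoint A B ∧ X = A ∪ B) :
    Reach n (s + T.card) (S ∪ T) := by
  classical
  induction T using Finset.induction_on with
  | empty => simpa using h
  | insert X T hX ih =>
    obtain ⟨A, hA, B, hB, hd, rfl⟩ := hT X (Finset.mem_insert_self _ _)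
    have := ih (fun Y hY => hT Y (Finset.mem_insert_of_mem hY))
    rw [Finset.card_insert_of_notMem hX]
    refine (this.step (Or.inl hA) (Or.inl hB) hd).mono (by omega) ?_
    intro Y hY
    simp only [Finset.coe_insert, Set.mem_union, Set.mem_insert_iff] at hY ⊢
    tauto

theorem Reach.powerset {s : ℕ} {S : Set (Finset (Fin n))} (h : Reach n s S)
    (hS : ∀ X : Finset (Fin n), X.card ≤ 1 → X ∈ S) (B : Finset (Fin n)) :
    Reach n (s + 2 ^ B.card) (S ∪ (B.powerset : Set (Finset (Fin n)))) := by
  classical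
  induction B using Finset.induction_on with
  | empty =>
    refine h.mono (Nat.le_add_right _ _) ?_
    rintro X (hX | hX)
    · exact hX
    · apply hS; simp at hX; simp [hX]
  | insert b B hb ih =>
    have := ih.many (B.powerset.image (insert b)) ?_
    · refine this.mono ?_ ?_
      · have := Finset.card_image_le (s := B.powerset) (f := insert b)
        rw [Finset.card_powerset] at this
        rw [Finset.card_insert_of_notMem hb, pow_succ]
        omega
      · rw [Finset.powerset_insert]
        intro Y hY
        simp only [Finset.coe_union, Set.mem_union] at hY ⊢
        tauto
    · intro X hX
      obtain ⟨Y, hY, rfl⟩ := Finset.mem_image.mp hX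
      refine ⟨{b}, Or.inl (hS _ (by simp)), Y, Or.inr (by simpa using hY), ?_, ?_⟩
      · rw [Finset.disjoint_singleton_left]
        exact fun h => hb (Finset.mem_powerset.mp hY h)
      · rfl

def blk (n k j : ℕ) : Finset (Fin n) := Finset.univ.filter (fun i => i.val / k = j)

theorem blk_card (k j : ℕ) (hk : 0 < k) : (blk n k j).card ≤ k := by
  have : (blk n k j).card ≤ (Finset.Ico (j * k) (j * k + k)).card := by
    apply Finset.card_le_card_of_injOn (fun i => i.val)
    · intro i hi
      simp only [blk, Finset.coe_filter, Finset.mem_univ, true_and, Set.mem_setOf_eq] at hi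
      simp only [Finset.coe_Ico, Set.mem_Ico]
      have := (Nat.div_eq_iff hk).mp hi
      omega
    · intro a _ b _ h; exact Fin.ext h
  simpa using this

theorem reach_blocks (k : ℕ) (hk : 0 < k) (m : ℕ) :
    Reach n (m * 2 ^ k) {X | X.card ≤ 1 ∨ ∃ j < m, X ⊆ blk n k j} := by
  induction m with
  | zero => simpa using Reach.base (n := n)
  | succ m ih =>
    have := ih.powerset (fun X hX => Or.inl hX) (blk n k m)
    refine this.mono ?_ ?_
    · have := Nat.pow_le_pow_right (n := 2) (by norm_num) (blk_card (n := n) k m hk)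
      rw [Nat.succ_mul]; omega
    · rintro X (hX | ⟨j, hj, hX⟩)
      · exact Or.inl (Or.inl hX)
      · rcases Nat.lt_succ_iff_lt_or_eq.mp hj with hj | rfl
        · exact Or.inl (Or.inr ⟨j, hj, hX⟩)
        · exact Or.inr (by simpa using hX)

theorem Reach.row {s k : ℕ} {S : Set (Finset (Fin n))} (h : Reach n s S) (M : ℕ)
    (h0 : ∅ ∈ S) (hS : ∀ j < M, ∀ X, X ⊆ blk n k j → X ∈ S) (R : Finset (Fin n)) (m : ℕ)
    (hm : m ≤ M) :
    Reach n (s + m) (insert (R.filter (fun i => i.val / k < m)) S) := by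
  induction m with
  | zero =>
    refine h.mono (by omega) ?_
    rintro X (rfl | hX)
    · simpa using h0
    · exact hX
  | succ m ih =>
    have := (ih (by omega)).step (A := R.filter (fun i => i.val / k < m))
      (B := R.filter (fun i => i.val / k = m)) (Or.inl rfl)
      (Or.inr (hS m (by omega) _ (by
        intro i hi
        simp only [blk, Finset.mem_filter, Finset.mem_univ, true_and] at hi ⊢
        exact hi.2))) ?_
    · refine this.mono (by omega) ?_
      rintro X (rfl | hX)
      · left
        ext i
        simp only [Finset.mem_union, Finset.mem_filter, Nat.lt_succ_iff_lt_or_eq]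
        tauto
      · exact Or.inr (Or.inr hX)
    · rw [Finset.disjoint_left]
      intro i hi hi'
      simp only [Finset.mem_filter] at hi hi'
      omega

theorem reach_rows (k : ℕ) (hk : 0 < k) (L : List (Finset (Fin n))) :
    Reach n ((n / k + 1) * 2 ^ k + L.length * (n / k + 1))
      ({X | X.card ≤ 1 ∨ ∃ j < n / k + 1, X ⊆ blk n k j} ∪ {X | X ∈ L}) := by
  induction L with
  | nil => simpa using reach_blocks (n := n) k hk (n / k + 1)
  | cons R L ih =>
    have := ih.row (k := k) (n / k + 1) (Or.inl (Or.inl (by simp)))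
      (fun j hj X hX => Or.inl (Or.inr ⟨j, hj, hX⟩)) R _ le_rfl
    refine this.mono ?_ ?_
    · rw [List.length_cons]; exact le_of_eq (by ring)
    · have e : R.filter (fun i => i.val / k < n / k + 1) = R := by
        rw [Finset.filter_eq_self]
        intro i _
        exact Nat.lt_succ_of_le (Nat.div_le_div_right i.isLt.le)
      rw [e]
      rintro X (hX | hX)
      · exact Or.inr (Or.inl hX)
      · rcases List.mem_cons.mp hX with rfl | hX
        · exact Or.inl rfl
        · exact Or.inr (Or.inr hX)

theorem upper (k : ℕ) (hk : 0 < k) (A : Matrix (Fin n) (Fin n) (ZMod 2))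
    (hA : ∀ o, ∃ j, A o j = 1) :
    ∃ C : LinCircuit n, C.CancellationFree ∧ C.Computes A ∧
      C.gates ≤ (n / k + 1) * 2 ^ k + n * (n / k + 1) := by
  let r : Fin n → Finset (Fin n) := fun o => Finset.univ.filter (fun j => A o j = 1)
  obtain ⟨C, hC, hl, hS⟩ := (reach_rows (n := n) k hk (List.ofFn r)).circuit
  rw [List.length_ofFn] at hC
  refine ⟨C, hl.cancellationFree, ?_, hC⟩
  have : ∀ o, ∃ v, v < n + C.gates ∧ C.val v = ind (r o) := by
    intro o
    apply hS
    · right; simp only [Set.mem_setOf_eq, List.mem_ofFn]; exact ⟨o, rfl⟩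
    · obtain ⟨j, hj⟩ := hA o
      exact ⟨j, by simp [r, hj]⟩
  choose out h1 h2 using this
  refine ⟨out, h1, fun o j => ?_⟩
  rw [h2]
  have : ∀ x : ZMod 2, (if x = 1 then (1 : ZMod 2) else 0) = x := by decide
  simpa [ind, r] using this (A o j)

theorem cfMin_le (k : ℕ) (hk : 0 < k) (hn : 2 ^ k ≤ n) (A : Matrix (Fin n) (Fin n) (ZMod 2)) :
    cfMin n A * k ≤ 4 * n ^ 2 := by
  by_cases hA : ∀ o, ∃ j, A o j = 1
  · obtain ⟨C, h1, h2, h3⟩ := upper k hk A hA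
    have h4 : cfMin n A ≤ C.gates := Nat.sInf_le ⟨C, h1, h2, rfl⟩
    have h5 : (n / k) * k ≤ n := Nat.div_mul_le_self n k
    have h6 : k ≤ n := (Nat.lt_two_pow_self.le).trans hn
    have h7 : cfMin n A ≤ (n / k + 1) * (2 * n) := by
      have := Nat.mul_le_mul_left (n / k + 1) hn
      nlinarith
    calc cfMin n A * k ≤ (n / k + 1) * (2 * n) * k := Nat.mul_le_mul_right _ h7
      _ = (n / k * k + k) * (2 * n) := by ring
      _ ≤ (n + n) * (2 * n) := Nat.mul_le_mul_right _ (by omega)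
      _ = 4 * n ^ 2 := by ring
  · have : {s | ∃ C : LinCircuit n, C.CancellationFree ∧ C.Computes A ∧ C.gates = s} = ∅ := by
      rw [Set.eq_empty_iff_forall_notMem]
      rintro s ⟨C, h1, ⟨out, h2, h3⟩, -⟩
      apply hA
      intro o
      obtain ⟨i, hi⟩ := h1.val_ne (out o) (h2 o)
      exact ⟨i, by rw [← h3, hi]⟩
    simp [cfMin, this]

theorem cf_zero_or (A : Matrix (Fin n) (Fin n) (ZMod 2)) :
    cfMin n A = 0 ∨ ∃ C : LinCircuit n, C.Computes A ∧ C.gates = linMin n A := by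
  rcases Set.eq_empty_or_nonempty
    {s | ∃ C : LinCircuit n, C.CancellationFree ∧ C.Computes A ∧ C.gates = s} with h | ⟨s, C, _, h, _⟩
  · left; simp [cfMin, h]
  · right
    exact Nat.sInf_mem (s := {s | ∃ C : LinCircuit n, C.Computes A ∧ C.gates = s}) ⟨_, C, h, rfl⟩

open Classical in
noncomputable def decode (n t : ℕ)
    (c : (Fin t → Fin (n + t)) × (Fin t → Fin (n + t)) × (Fin n → Fin (n + t))) :
    Matrix (Fin n) (Fin n) (ZMod 2) :=
  if h : (∀ g, (c.1 g).val < n + g.val) ∧ (∀ g, (c.2.1 g).val < n + g.val) then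
    fun o j => (LinCircuit.mk t (fun g => (c.1 g).val) (fun g => (c.2.1 g).val) h.1 h.2).val (c.2.2 o) j
  else 0

theorem count (n t : ℕ) :
    {A : Matrix (Fin n) (Fin n) (ZMod 2) | ∃ C : LinCircuit n, C.Computes A ∧ C.gates = t}.ncard
      ≤ (n + t) ^ (2 * t + n) := by
  have hsub : {A : Matrix (Fin n) (Fin n) (ZMod 2) |
      ∃ C : LinCircuit n, C.Computes A ∧ C.gates = t} ⊆ decode n t '' Set.univ := by
    rintro A ⟨⟨t', l, r, hl, hr⟩, ⟨out, h1, h2⟩, rfl⟩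
    simp only at h1 ⊢
    refine ⟨⟨fun g => ⟨l g, (hl g).trans (by omega)⟩, fun g => ⟨r g, (hr g).trans (by omega)⟩,
      fun o => ⟨out o, h1 o⟩⟩, trivial, ?_⟩
    refine (dif_pos (⟨hl, hr⟩ : (∀ g, l g < n + g.val) ∧ (∀ g, r g < n + g.val))).trans ?_
    funext o j
    exact h2 o j
  refine (Set.ncard_le_ncard hsub (Set.toFinite _)).trans ((Set.ncard_image_le).trans ?_)
  rw [Set.ncard_univ, Nat.card_eq_fintype_card]
  simp only [Fintype.card_prod, Fintype.card_fun, Fintype.card_fin]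
  apply le_of_eq
  ring

theorem count_le (n s : ℕ) (hn : 1 ≤ n) :
    {A : Matrix (Fin n) (Fin n) (ZMod 2) | ∃ C : LinCircuit n, C.Computes A ∧ C.gates ≤ s}.ncard
      ≤ (n + s) ^ (2 * s + n + 1) := by
  have : {A : Matrix (Fin n) (Fin n) (ZMod 2) | ∃ C : LinCircuit n, C.Computes A ∧ C.gates ≤ s}
      ⊆ ⋃ t ∈ Finset.range (s + 1), {A : Matrix (Fin n) (Fin n) (ZMod 2) |
        ∃ C : LinCircuit n, C.Computes A ∧ C.gates = t} := by
    rintro A ⟨C, h, hs⟩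
    simp only [Set.mem_iUnion]
    exact ⟨C.gates, Finset.mem_range.mpr (by omega), C, h, rfl⟩
  refine (Set.ncard_le_ncard this (Set.toFinite _)).trans
    ((Finset.set_ncard_biUnion_le _ _).trans ?_)
  calc _ ≤ ∑ t ∈ Finset.range (s + 1), (n + s) ^ (2 * s + n) := by
        apply Finset.sum_le_sum
        intro t ht
        have ht := Finset.mem_range.mp ht
        refine (count n t).trans ((Nat.pow_le_pow_left (by omega) _).trans
          (Nat.pow_le_pow_right (by omega) (by omega)))
    _ = (s + 1) * (n + s) ^ (2 * s + n) := by simp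
    _ ≤ (n + s) * (n + s) ^ (2 * s + n) := Nat.mul_le_mul_right _ (by omega)
    _ = _ := by ring

theorem bad_count (n : ℕ) (hn : 1024 ≤ n) :
    {A : Matrix (Fin n) (Fin n) (ZMod 2) | ∃ C : LinCircuit n, C.Computes A ∧
      C.gates ≤ n ^ 2 / (16 * Nat.log 2 n)}.ncard * 2 ^ n ≤ 2 ^ (n ^ 2) := by
  set k := Nat.log 2 n with hk
  have hk10 : 10 ≤ k := by
    rw [hk]; exact (Nat.le_log_iff_pow_le (by norm_num) (by omega)).mpr (by simpa using hn)
  have h1 : 2 ^ k ≤ n := Nat.pow_log_le_self 2 (by omega)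
  have h2 : n < 2 ^ (k + 1) := Nat.lt_pow_succ_log_self (by norm_num) n
  have h3 : 100 * k ≤ 2 ^ k := by
    clear_value k
    clear hk h1 h2
    induction k, hk10 using Nat.le_induction with
    | base => norm_num
    | succ k hk ih => rw [pow_succ]; omega
  set s := n ^ 2 / (16 * k) with hs
  have h4 : s * (16 * k) ≤ n ^ 2 := Nat.div_mul_le_self _ _
  have h5 : n + s ≤ n ^ 2 := by nlinarith
  have h6 : n + s ≤ 2 ^ (4 * k) := by
    calc n + s ≤ n ^ 2 := h5
      _ ≤ (2 ^ (k + 1)) ^ 2 := Nat.pow_le_pow_left h2.le 2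
      _ = 2 ^ (2 * (k + 1)) := by rw [← pow_mul, mul_comm]
      _ ≤ _ := Nat.pow_le_pow_right (by norm_num) (by omega)
  calc _ ≤ (n + s) ^ (2 * s + n + 1) * 2 ^ n :=
        Nat.mul_le_mul_right _ (count_le n s (by omega))
    _ ≤ (2 ^ (4 * k)) ^ (2 * s + n + 1) * 2 ^ n :=
        Nat.mul_le_mul_right _ (Nat.pow_le_pow_left h6 _)
    _ = 2 ^ (4 * k * (2 * s + n + 1) + n) := by rw [← pow_mul, ← pow_add]
    _ ≤ _ := by
        apply Nat.pow_le_pow_right (by norm_num)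
        have h7 : 100 * k * (n + 1) ≤ n * (n + 1) := Nat.mul_le_mul_right _ (h3.trans h1)
        nlinarith

theorem good_sub (n : ℕ) (hn : 1024 ≤ n) (A : Matrix (Fin n) (Fin n) (ZMod 2))
    (hA : ¬ ∃ C : LinCircuit n, C.Computes A ∧ C.gates ≤ n ^ 2 / (16 * Nat.log 2 n)) :
    (cfMin n A : ℝ) ≤ 64 * (linMin n A : ℝ) := by
  suffices h : cfMin n A ≤ 64 * linMin n A by exact_mod_cast h
  set k := Nat.log 2 n with hk
  have hk0 : 0 < k := Nat.log_pos (by norm_num) (by omega)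
  have h1 : 2 ^ k ≤ n := Nat.pow_log_le_self 2 (by omega)
  rcases cf_zero_or A with h | ⟨C, hC, hg⟩
  · simp [h]
  · have h2 : n ^ 2 / (16 * k) < linMin n A := by
      rw [← hg]; by_contra h; exact hA ⟨C, hC, not_lt.mp h⟩
    have h3 := (Nat.div_lt_iff_lt_mul (by omega)).mp h2
    have h4 := cfMin_le k hk0 h1 A
    refine Nat.le_of_mul_le_mul_right (c := k) ?_ hk0
    nlinarith

end LinCircuit

/-- There exists a constant `c > 0` such that the fraction of
`n × n` matrices `M` over `F_2` for which the minimum size of a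
cancellation-free linear circuit computing `M` is at most `c` times the
minimum size of a linear circuit computing `M` tends to `1` as `n → ∞`:
for almost every matrix the cancellation ratio is bounded by a constant. -/
theorem cancellation_ratio_constant_for_almost_all :
    ∃ c : ℝ, 0 < c ∧
      Filter.Tendsto (fun n : ℕ =>
        ({A : Matrix (Fin n) (Fin n) (ZMod 2) |
            (cfMin n A : ℝ) ≤ c * (linMin n A : ℝ)}.ncard : ℝ) / 2 ^ (n ^ 2))
        Filter.atTop (nhds 1) := by
  refine ⟨64, by norm_num, ?_⟩
  have hcard : ∀ n : ℕ, Nat.card (Matrix (Fin n) (Fin n) (ZMod 2)) = 2 ^ (n ^ 2) := by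
    intro n
    rw [Nat.card_eq_fintype_card]
    have h : Fintype.card (Fin n → Fin n → ZMod 2) = 2 ^ (n ^ 2) := by
      simp only [Fintype.card_fun, ZMod.card, Fintype.card_fin]
      rw [← pow_mul, sq]
    rw [← h]
    exact Fintype.card_congr (Equiv.refl _)
  have hlim : Filter.Tendsto (fun n : ℕ => 1 - (1 / 2 : ℝ) ^ n) Filter.atTop (nhds 1) := by
    have := (tendsto_pow_atTop_nhds_zero_of_lt_one (r := (1 / 2 : ℝ)) (by norm_num)
      (by norm_num)).const_sub 1
    simpa using this
  refine tendsto_of_tendsto_of_tendsto_of_le_of_le' hlim tendsto_const_nhds ?_ ?_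
  · filter_upwards [Filter.eventually_ge_atTop 1024] with n hn
    rw [le_div_iff₀ (by positivity)]
    have hb := LinCircuit.bad_count n hn
    set bad := {A : Matrix (Fin n) (Fin n) (ZMod 2) | ∃ C : LinCircuit n, C.Computes A ∧
      C.gates ≤ n ^ 2 / (16 * Nat.log 2 n)} with hbad
    have hsub : badᶜ ⊆ {A : Matrix (Fin n) (Fin n) (ZMod 2) |
            (cfMin n A : ℝ) ≤ 64 * (linMin n A : ℝ)} := fun A hA =>
      LinCircuit.good_sub n hn A hA
    have h1 := Set.ncard_le_ncard hsub (Set.toFinite _)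
    have h2 := Set.ncard_add_ncard_compl bad
    rw [hcard] at h2
    have h3 : (bad.ncard : ℝ) + (badᶜ.ncard : ℝ) = 2 ^ (n ^ 2) := by exact_mod_cast h2
    have h4 : (bad.ncard : ℝ) * 2 ^ n ≤ 2 ^ (n ^ 2) := by exact_mod_cast hb
    have h5 : (badᶜ.ncard : ℝ) ≤ _ := Nat.cast_le.mpr h1
    refine le_trans ?_ h5
    have h6 : (bad.ncard : ℝ) ≤ (1 / 2) ^ n * 2 ^ (n ^ 2) := by
      rw [one_div, inv_pow, ← div_eq_inv_mul, le_div_iff₀ (by positivity)]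
      exact h4
    linarith
  · refine Filter.Eventually.of_forall fun n => ?_
    rw [div_le_one (by positivity)]
    have := Set.ncard_le_card {A : Matrix (Fin n) (Fin n) (ZMod 2) |
            (cfMin n A : ℝ) ≤ 64 * (linMin n A : ℝ)}
    rw [hcard] at this
    exact_mod_cast this
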